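/- arXiv:math/0109019 — 2 statements merged into one kernel-verified Lean document; each statement's English description precedes it below -/
import Mathlib

section
/- Let A₄ be the alternating group on 4 letters and let V = {1, (1 2)(3 4), (1 3)(2 4), (1 4)(2 3)} be its Klein four subgroup. There exists a group automorphism φ of V such that for every v ∈ V the element φ(v) is conjugate to v in A₄, but there is no single element g ∈ A₄ with φ(v) = g v g⁻¹ for all v ∈ V. (Hence the Quillen category A(A₄) is strictly contained in the category A^(1)(A₄) at the prime 2: the automorphism group of V in A(A₄) is C₃ while in A^(1)(A₄) it is the full group S₃.) -/
/-- The double transposition (1 2)(3 4) in `A₄`. -/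
def dt1 : alternatingGroup (Fin 4) :=
  ⟨Equiv.swap 0 1 * Equiv.swap 2 3, by rw [Equiv.Perm.mem_alternatingGroup]; decide⟩

/-- The double transposition (1 3)(2 4) in `A₄`. -/
def dt2 : alternatingGroup (Fin 4) :=
  ⟨Equiv.swap 0 2 * Equiv.swap 1 3, by rw [Equiv.Perm.mem_alternatingGroup]; decide⟩

/-- The double transposition (1 4)(2 3) in `A₄`. -/
def dt3 : alternatingGroup (Fin 4) :=
  ⟨Equiv.swap 0 3 * Equiv.swap 1 2, by rw [Equiv.Perm.mem_alternatingGroup]; decide⟩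

/-- Conjugation by the transposition `(1 2)`, as an automorphism of `A₄`. -/
def conjSwap : MulAut (alternatingGroup (Fin 4)) :=
  MulAut.conjNormal (Equiv.swap 0 1)

theorem conjSwap_dt1 : conjSwap dt1 = dt1 := by
  apply Subtype.ext
  rw [conjSwap, MulAut.conjNormal_apply]
  decide

theorem conjSwap_dt2 : conjSwap dt2 = dt3 := by
  apply Subtype.ext
  rw [conjSwap, MulAut.conjNormal_apply]
  decide

theorem conjSwap_dt3 : conjSwap dt3 = dt2 := by
  apply Subtype.ext
  rw [conjSwap, MulAut.conjNormal_apply]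
  decide

theorem isConj_dt2_dt3 : IsConj dt2 dt3 := by
  refine isConj_iff.2 ⟨⟨Equiv.swap 1 2 * Equiv.swap 2 3, ?_⟩, Subtype.ext ?_⟩
  · rw [Equiv.Perm.mem_alternatingGroup]
    decide
  · decide

theorem not_conj_dt1_dt1_and_dt2_dt3 (g : alternatingGroup (Fin 4))
    (h₁ : g * dt1 * g⁻¹ = dt1) (h₂ : g * dt2 * g⁻¹ = dt3) : False := by
  have key : ∀ σ : Equiv.Perm (Fin 4), Equiv.Perm.sign σ = 1 →
      σ * (dt1 : Equiv.Perm (Fin 4)) = dt1 * σ →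
      σ * (dt2 : Equiv.Perm (Fin 4)) ≠ dt3 * σ := by
    decide
  exact key g (Equiv.Perm.mem_alternatingGroup.1 g.2)
    (congrArg Subtype.val (mul_inv_eq_iff_eq_mul.1 h₁))
    (congrArg Subtype.val (mul_inv_eq_iff_eq_mul.1 h₂))

/-- there is an automorphism of the Klein four subgroup `V ≤ A₄` taking
every element to an `A₄`-conjugate of itself, which is nevertheless not induced by
conjugation by any single element of `A₄`. -/
theorem exists_nonconjugation_automorphism (V : Subgroup (alternatingGroup (Fin 4)))
    (hV : (V : Set (alternatingGroup (Fin 4))) = {1, dt1, dt2, dt3}) :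
    ∃ φ : V ≃* V,
      (∀ v : V, ∃ g : alternatingGroup (Fin 4), (φ v : alternatingGroup (Fin 4)) =
        g * (v : alternatingGroup (Fin 4)) * g⁻¹) ∧
      ¬ ∃ g : alternatingGroup (Fin 4), ∀ v : V, (φ v : alternatingGroup (Fin 4)) =
        g * (v : alternatingGroup (Fin 4)) * g⁻¹ := by
  have mem_iff (x) : x ∈ V ↔ x = 1 ∨ x = dt1 ∨ x = dt2 ∨ x = dt3 := by
    rw [← SetLike.mem_coe, hV]
    simp only [Set.mem_insert_iff, Set.mem_singleton_iff]
  have hmap : V.map conjSwap.toMonoidHom = V := by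
    apply SetLike.coe_injective
    rw [Subgroup.coe_map, hV]
    simp only [Set.image_insert_eq, Set.image_singleton, MulEquiv.toMonoidHom_eq_coe,
      MonoidHom.coe_coe, map_one, conjSwap_dt1, conjSwap_dt2, conjSwap_dt3]
    rw [Set.pair_comm dt3 dt2]
  have hconj : ∀ x ∈ V, IsConj x (conjSwap x) := by
    intro x hx
    rcases (mem_iff x).1 hx with rfl | rfl | rfl | rfl
    · rw [map_one]
    · rw [conjSwap_dt1]
    · rw [conjSwap_dt2]
      exact isConj_dt2_dt3
    · rw [conjSwap_dt3]
      exact isConj_dt2_dt3.symm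
  refine ⟨(conjSwap.subgroupMap V).trans (MulEquiv.subgroupCongr hmap), ?_, ?_⟩
  · intro v
    obtain ⟨g, hg⟩ := isConj_iff.1 (hconj v v.2)
    exact ⟨g, hg.symm⟩
  · rintro ⟨g, hg⟩
    have h₁ : conjSwap dt1 = g * dt1 * g⁻¹ := hg ⟨dt1, (mem_iff _).2 (by simp)⟩
    have h₂ : conjSwap dt2 = g * dt2 * g⁻¹ := hg ⟨dt2, (mem_iff _).2 (by simp)⟩
    rw [conjSwap_dt1] at h₁
    rw [conjSwap_dt2] at h₂
    exact not_conj_dt1_dt1_and_dt2_dt3 g h₁.symm h₂.symm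
end

section
/- Let σ be the 𝔽₂-algebra automorphism of the polynomial ring 𝔽₂[x, y] determined by σ(x) = y and σ(y) = x + y (an automorphism of order 3). Then the subalgebra of σ-invariant polynomials {q ∈ 𝔽₂[x, y] : σ(q) = q} is exactly the 𝔽₂-subalgebra generated by the three elements D₁ = x² + x y + y², D₀ = x² y + x y², and η = x³ + x² y + y³. (This computes the mod 2 cohomology ring H*(BA₄) ≅ 𝔽₂[x, y]^{C₃} as the invariants of the Weyl group action of C₃ on the cohomology of the Sylow 2-subgroup.) -/
open MvPolynomial

/-- The Dickson invariant `D₁ = x² + xy + y²` in `𝔽₂[x, y]`. -/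
noncomputable def D1 : MvPolynomial (Fin 2) (ZMod 2) := X 0 ^ 2 + X 0 * X 1 + X 1 ^ 2

/-- The Dickson invariant `D₀ = x²y + xy²` in `𝔽₂[x, y]`. -/
noncomputable def D0 : MvPolynomial (Fin 2) (ZMod 2) := X 0 ^ 2 * X 1 + X 0 * X 1 ^ 2

/-- The orbit sum `η = x³ + x²y + y³` in `𝔽₂[x, y]`. -/
noncomputable def eta : MvPolynomial (Fin 2) (ZMod 2) := X 0 ^ 3 + X 0 ^ 2 * X 1 + X 1 ^ 3

theorem MvPolynomial.two_eq_zero_of_zmod_two {τ : Type*} :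
    (2 : MvPolynomial τ (ZMod 2)) = 0 :=
  CharTwo.two_eq_zero

/-- `𝔽₂[x, y]` is generated by `1, x, x², y, xy, x²y` as a module over any subalgebra
containing the Dickson invariants. -/
theorem exists_eq_of_dickson_mem (A : Subalgebra (ZMod 2) (MvPolynomial (Fin 2) (ZMod 2)))
    (h1 : D1 ∈ A) (h0 : D0 ∈ A) (q : MvPolynomial (Fin 2) (ZMod 2)) :
    ∃ a ∈ A, ∃ b ∈ A, ∃ c ∈ A, ∃ d ∈ A, ∃ e ∈ A, ∃ f ∈ A,
      q = a + b * X 0 + c * X 0 ^ 2 + d * X 1 + e * (X 0 * X 1) + f * (X 0 ^ 2 * X 1) := by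
  have h2 := MvPolynomial.two_eq_zero_of_zmod_two (τ := Fin 2)
  have hx3 : (X 0 : MvPolynomial (Fin 2) (ZMod 2)) ^ 3 = D1 * X 0 + D0 := by
    unfold D1 D0
    linear_combination (-(X 0 ^ 2 * X 1) - X 0 * X 1 ^ 2) * h2
  have hy2 : (X 1 : MvPolynomial (Fin 2) (ZMod 2)) ^ 2 = D1 + X 0 ^ 2 + X 0 * X 1 := by
    unfold D1
    linear_combination (-(X 0 ^ 2) - X 0 * X 1) * h2
  induction q using MvPolynomial.induction_on with
  | C r =>
    exact ⟨C r, A.algebraMap_mem r, 0, A.zero_mem, 0, A.zero_mem, 0, A.zero_mem,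
      0, A.zero_mem, 0, A.zero_mem, by ring⟩
  | add p q hp hq =>
    obtain ⟨a, ha, b, hb, c, hc, d, hd, e, he, f, hf, rfl⟩ := hp
    obtain ⟨a', ha', b', hb', c', hc', d', hd', e', he', f', hf', rfl⟩ := hq
    exact ⟨a + a', add_mem ha ha', b + b', add_mem hb hb', c + c', add_mem hc hc',
      d + d', add_mem hd hd', e + e', add_mem he he', f + f', add_mem hf hf', by ring⟩
  | mul_X p i hp =>
    obtain ⟨a, ha, b, hb, c, hc, d, hd, e, he, f, hf, rfl⟩ := hp
    fin_cases i
    · refine ⟨c * D0, mul_mem hc h0, a + c * D1, add_mem ha (mul_mem hc h1), b, hb,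
        f * D0, mul_mem hf h0, d + f * D1, add_mem hd (mul_mem hf h1), e, he, ?_⟩
      simp only [Fin.zero_eta]
      linear_combination (c + f * X 1) * hx3
    · refine ⟨d * D1 + e * D0, add_mem (mul_mem hd h1) (mul_mem he h0),
        f * D0, mul_mem hf h0, d, hd, a + f * D0, add_mem ha (mul_mem hf h0),
        b + d + f * D1, add_mem (add_mem hb hd) (mul_mem hf h1), c + e, add_mem hc he, ?_⟩
      simp only [Fin.mk_one]
      linear_combination (d + e * X 0 + f * X 0 ^ 2) * hy2
        + (e + f * X 0 + f * X 1) * hx3 + (e * D1 * X 0 + f * D1 * X 0 ^ 2) * h2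

/-- the invariants of the order-3 automorphism `σ` of `𝔽₂[x, y]` with
`σ(x) = y`, `σ(y) = x + y` form exactly the subalgebra generated by `D₁`, `D₀` and `η`. -/
theorem invariants_eq_adjoin_D1_D0_eta
    (σ : MvPolynomial (Fin 2) (ZMod 2) ≃ₐ[ZMod 2] MvPolynomial (Fin 2) (ZMod 2))
    (hx : σ (X 0) = X 1) (hy : σ (X 1) = X 0 + X 1) :
    ∀ q : MvPolynomial (Fin 2) (ZMod 2),
      σ q = q ↔ q ∈ Algebra.adjoin (ZMod 2) ({D1, D0, eta} :
        Set (MvPolynomial (Fin 2) (ZMod 2))) := by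
  have h2 := MvPolynomial.two_eq_zero_of_zmod_two (τ := Fin 2)
  set A := Algebra.adjoin (ZMod 2) ({D1, D0, eta} : Set (MvPolynomial (Fin 2) (ZMod 2))) with hA
  have h1A : D1 ∈ A := Algebra.subset_adjoin (by simp)
  have h0A : D0 ∈ A := Algebra.subset_adjoin (by simp)
  have hηA : eta ∈ A := Algebra.subset_adjoin (by simp)
  have hfix : ∀ a ∈ A, σ a = a := by
    have hle : A ≤ AlgHom.equalizer (σ : _ →ₐ[ZMod 2] MvPolynomial (Fin 2) (ZMod 2))
        (AlgHom.id (ZMod 2) _) := by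
      refine Algebra.adjoin_le ?_
      rintro p (rfl | rfl | rfl)
      · change σ D1 = D1
        simp only [D1, map_add, map_mul, map_pow, hx, hy]
        linear_combination (X 1 ^ 2 + X 0 * X 1) * h2
      · change σ D0 = D0
        simp only [D0, map_add, map_mul, map_pow, hx, hy]
        linear_combination (X 1 ^ 3 + X 0 * X 1 ^ 2) * h2
      · change σ eta = eta
        simp only [eta, map_add, map_mul, map_pow, hx, hy]
        linear_combination (X 1 ^ 3 + X 0 ^ 2 * X 1 + 2 * X 0 * X 1 ^ 2) * h2
    exact fun a ha => hle ha
  intro q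
  refine ⟨fun hq => ?_, hfix q⟩
  obtain ⟨a, ha, b, hb, c, hc, d, hd, e, he, f, hf, hqe⟩ := exists_eq_of_dickson_mem A h1A h0A q
  have hσ := congrArg σ hqe
  simp only [map_add, map_mul, map_pow, hx, hy, hfix a ha, hfix b hb, hfix c hc, hfix d hd,
    hfix e he, hfix f hf, hq] at hσ
  have hσσ := congrArg σ hσ
  simp only [map_add, map_mul, map_pow, hx, hy, hfix a ha, hfix b hb, hfix c hc, hfix d hd,
    hfix e he, hfix f hf, hq] at hσσ
  have htr : q = a + e * D1 + f * eta := by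
    unfold D1 eta
    grind
  rw [htr]
  exact add_mem (add_mem ha (mul_mem he h1A)) (mul_mem hf hηA)
end
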